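/- (Sharpness of local smoothing exponent) For $n \ge 2$ and $\gamma > (n-1)/2$, there is NO constant $C$ and nonzero $\beta \in C_0^\infty(\mathbb{R}^n)$ with $\beta \equiv 1$ on the unit ball such that $\int_{-\infty}^{\infty} \|\beta e^{it|D|} f\|^2_{H^\gamma} dt \le C \|f\|^2_{\dot H^\gamma}$ holds for all Schwartz $f$. -/

import Mathlib

open MeasureTheory Real Set FourierTransform
open scoped RealInnerProductSpace

noncomputable section

abbrev Euc (n : ℕ) := EuclideanSpace ℝ (Fin n)

/-- Fourier multiplier operator with symbol `m`. -/
def mulOp {n : ℕ} (m : Euc n → ℂ) (f : Euc n → ℂ) (x : Euc n) : ℂ :=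
  ∫ ξ : Euc n, Complex.exp (2 * π * Complex.I * (⟪x, ξ⟫ : ℝ)) * m ξ * (𝓕 f ξ)

/-- Half-wave propagator `e^{it|D|}`. -/
def halfWave {n : ℕ} (t : ℝ) (f : Euc n → ℂ) : Euc n → ℂ :=
  mulOp (fun ξ => Complex.exp (Complex.I * t * ‖ξ‖)) f

/-- Homogeneous Sobolev norm `‖f‖_{Ḣˢ}`. -/
def hSob (n : ℕ) (s : ℝ) (f : Euc n → ℂ) : ℝ :=
  (∫ ξ : Euc n, ‖ξ‖ ^ (2 * s) * ‖𝓕 f ξ‖ ^ 2) ^ (1/2 : ℝ)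

/-- Inhomogeneous Sobolev norm `‖f‖_{Hˢ}`. -/
def iSob (n : ℕ) (s : ℝ) (f : Euc n → ℂ) : ℝ :=
  (∫ ξ : Euc n, (1 + ‖ξ‖ ^ 2) ^ s * ‖𝓕 f ξ‖ ^ 2) ^ (1/2 : ℝ)

/-- `L²` norm of `g` on the sphere of radius `r` (unit-sphere surface measure). -/
def sphL2 {n : ℕ} (g : Euc n → ℂ) (r : ℝ) : ℝ :=
  (∫ ω : Metric.sphere (0 : Euc n) 1, ‖g (r • (ω : Euc n))‖ ^ 2
      ∂((volume : Measure (Euc n)).toSphere)) ^ (1/2 : ℝ)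


/-- The Fourier side of `β e^{it|D|} f`. -/
def GG {n : ℕ} (B φ : Euc n → ℂ) (t : ℝ) (ξ : Euc n) : ℂ :=
  ∫ η : Euc n, B (ξ - η) * φ η * Complex.exp (Complex.I * t * ‖η‖)

lemma norm_osc (t r : ℝ) : ‖Complex.exp (Complex.I * t * r)‖ = 1 := by
  have := Complex.norm_exp_I_mul_ofReal (t * r)
  push_cast at this
  rw [mul_assoc]; exact this

lemma GG_integrable {n : ℕ} (B : SchwartzMap (Euc n) ℂ) (φ : Euc n → ℂ) (hφ : Continuous φ)
    (hs : HasCompactSupport φ) (t : ℝ) (ξ : Euc n) :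
    Integrable (fun η : Euc n => B (ξ - η) * φ η * Complex.exp (Complex.I * t * ‖η‖)) := by
  apply Continuous.integrable_of_hasCompactSupport
  · have := B.continuous
    fun_prop
  · exact (hs.mul_left).mul_right

lemma GG_decay {n : ℕ} (B : SchwartzMap (Euc n) ℂ) (φ : Euc n → ℂ) (hφ : Continuous φ)
    (hs : HasCompactSupport φ) (N : ℕ) :
    ∃ K : ℝ, 0 ≤ K ∧ ∀ t ξ, (1 + ‖ξ‖) ^ N * ‖GG B φ t ξ‖ ≤ K := by
  obtain ⟨R, hR⟩ := hs.isCompact.isBounded.exists_norm_le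
  set S : ℝ := 2 ^ N * (Finset.Iic ((N, 0) : ℕ × ℕ)).sup
      (fun m => SchwartzMap.seminorm ℝ m.1 m.2) B with hS
  have hB : ∀ x, (1 + ‖x‖) ^ N * ‖B x‖ ≤ S := fun x => by
    simpa using SchwartzMap.one_add_le_sup_seminorm_apply (𝕜 := ℝ) (m := (N, 0)) le_rfl le_rfl B x
  have hS0 : 0 ≤ S := le_trans (by positivity) (hB 0)
  have hφi : Integrable φ := hφ.integrable_of_hasCompactSupport hs
  refine ⟨∫ η, (1 + |R|) ^ N * S * ‖φ η‖, integral_nonneg fun η => by positivity, fun t ξ => ?_⟩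
  have h1 : ‖GG B φ t ξ‖ ≤ ∫ η, ‖B (ξ - η)‖ * ‖φ η‖ := by
    refine (norm_integral_le_integral_norm _).trans (le_of_eq ?_)
    congr 1; ext η
    rw [norm_mul, norm_mul, norm_osc, mul_one]
  calc (1 + ‖ξ‖) ^ N * ‖GG B φ t ξ‖ ≤ (1 + ‖ξ‖) ^ N * ∫ η, ‖B (ξ - η)‖ * ‖φ η‖ := by gcongr
    _ = ∫ η, (1 + ‖ξ‖) ^ N * (‖B (ξ - η)‖ * ‖φ η‖) := (integral_const_mul _ _).symm
    _ ≤ _ := by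
      apply integral_mono_of_nonneg
      · exact Filter.Eventually.of_forall fun η => by positivity
      · exact hφi.norm.const_mul _
      · refine Filter.Eventually.of_forall fun η => ?_
        by_cases hη : φ η = 0
        · simp [hη]
        have hηR : ‖η‖ ≤ |R| := (hR η (subset_tsupport _ hη)).trans (le_abs_self R)
        have h2 : 1 + ‖ξ‖ ≤ (1 + |R|) * (1 + ‖ξ - η‖) := by
          have : ‖ξ‖ ≤ ‖ξ - η‖ + ‖η‖ := by simpa using norm_add_le (ξ - η) η
          nlinarith [norm_nonneg (ξ - η), abs_nonneg R]
        have h3 : (1 + ‖ξ‖) ^ N ≤ (1 + |R|) ^ N * (1 + ‖ξ - η‖) ^ N := by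
          rw [← mul_pow]; gcongr
        calc (1 + ‖ξ‖) ^ N * (‖B (ξ - η)‖ * ‖φ η‖)
            ≤ ((1 + |R|) ^ N * (1 + ‖ξ - η‖) ^ N) * (‖B (ξ - η)‖ * ‖φ η‖) := by gcongr
          _ = (1 + |R|) ^ N * ((1 + ‖ξ - η‖) ^ N * ‖B (ξ - η)‖) * ‖φ η‖ := by ring
          _ ≤ (1 + |R|) ^ N * S * ‖φ η‖ := by gcongr; exact hB _

lemma GG_continuous {n : ℕ} (B : SchwartzMap (Euc n) ℂ) (φ : Euc n → ℂ) (hφ : Continuous φ)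
    (hs : HasCompactSupport φ) :
    Continuous (fun p : ℝ × Euc n => GG B φ p.1 p.2) := by
  have hB := B.continuous
  obtain ⟨S, hS⟩ : ∃ S, ∀ x, ‖B x‖ ≤ S :=
    ⟨_, fun x => SchwartzMap.norm_le_seminorm ℝ B x⟩
  have hφi : Integrable φ := hφ.integrable_of_hasCompactSupport hs
  unfold GG
  apply continuous_of_dominated (bound := fun η => S * ‖φ η‖)
  · intro p
    apply Continuous.aestronglyMeasurable
    fun_prop
  · intro p
    refine Filter.Eventually.of_forall fun η => ?_
    rw [norm_mul, norm_mul, norm_osc, mul_one]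
    gcongr
    exact hS _
  · exact hφi.norm.const_mul _
  · refine Filter.Eventually.of_forall fun η => ?_
    fun_prop

open LineDeriv in
lemma GG_ibp {n : ℕ} (B : SchwartzMap (Euc n) ℂ) (φ ψ : Euc n → ℂ) (e : Euc n)
    (hψ : ContDiff ℝ 1 ψ) (hs : HasCompactSupport ψ) (h0 : (0 : Euc n) ∉ tsupport ψ)
    (hφ : ∀ η, φ η = ψ η * ((⟪e, η⟫ / ‖η‖ : ℝ) : ℂ)) (t : ℝ) (ξ : Euc n) :
    Complex.I * t * GG B φ t ξ =
      GG (∂_{e} B : SchwartzMap (Euc n) ℂ) ψ t ξ - GG B (fun η => fderiv ℝ ψ η e) t ξ := by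
  have hBc := B.continuous
  have hψc := hψ.continuous
  have hψ'c : Continuous (fun η => fderiv ℝ ψ η e) :=
    (hψ.continuous_fderiv one_ne_zero).clm_apply continuous_const
  have hψ's : HasCompactSupport (fun η => fderiv ℝ ψ η e) := hs.fderiv_apply ℝ e
  have hfd : ∀ η, HasFDerivAt (fun η => B (ξ - η) * ψ η)
      (B (ξ - η) • fderiv ℝ ψ η + ψ η • (-(fderiv ℝ B (ξ - η)))) η := by
    intro η
    have h1 : HasFDerivAt (fun η => B (ξ - η)) (-(fderiv ℝ B (ξ - η))) η := by
      have := (B.differentiableAt (x := ξ - η)).hasFDerivAt.comp η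
        ((hasFDerivAt_id η).const_sub ξ)
      exact this.congr_fderiv (ContinuousLinearMap.ext fun x => by simp)
    exact h1.mul (hψ.differentiable one_ne_zero η).hasFDerivAt
  have hgd : ∀ η : Euc n, η ≠ 0 → HasFDerivAt (fun η : Euc n => Complex.exp (Complex.I * t * ‖η‖))
      ((Complex.exp (Complex.I * t * ‖η‖) * (Complex.I * t)) •
        (Complex.ofRealCLM.comp (‖η‖⁻¹ • innerSL ℝ η))) η := by
    intro η hη
    have h1 : HasFDerivAt (fun η : Euc n => ‖η‖) (‖η‖⁻¹ • innerSL ℝ η) η := by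
      have := ((hasStrictFDerivAt_norm_sq η).hasFDerivAt).sqrt (by positivity)
      simp only [Real.sqrt_sq (norm_nonneg _)] at this
      refine this.congr_fderiv (ContinuousLinearMap.ext fun x => ?_)
      have : ‖η‖ ≠ 0 := by simpa
      simp; field_simp
    have h2 := ((Complex.ofRealCLM.hasFDerivAt.comp η h1).const_mul (Complex.I * t)).cexp
    refine h2.congr_fderiv (ContinuousLinearMap.ext fun x => ?_)
    simp [mul_assoc]
  have hgd' : ∀ η : Euc n, ψ η ≠ 0 →
      fderiv ℝ (fun η : Euc n => Complex.exp (Complex.I * t * ‖η‖)) η e =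
        Complex.I * t * ((⟪e, η⟫ / ‖η‖ : ℝ) : ℂ) * Complex.exp (Complex.I * t * ‖η‖) := by
    intro η hη
    have hη0 : η ≠ 0 := fun h => h0 (h ▸ subset_tsupport _ hη)
    rw [(hgd η hη0).fderiv]
    simp [real_inner_comm]; ring
  have e1 : ∀ η, (B (ξ - η) * ψ η) *
      fderiv ℝ (fun η : Euc n => Complex.exp (Complex.I * t * ‖η‖)) η e
      = Complex.I * t * (B (ξ - η) * φ η * Complex.exp (Complex.I * t * ‖η‖)) := by
    intro η
    by_cases hη : ψ η = 0
    · simp [hφ, hη]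
    · rw [hgd' η hη, hφ]; ring
  have e2 : ∀ η, fderiv ℝ (fun η => B (ξ - η) * ψ η) η e * Complex.exp (Complex.I * t * ‖η‖)
      = B (ξ - η) * fderiv ℝ ψ η e * Complex.exp (Complex.I * t * ‖η‖)
        - (∂_{e} B : SchwartzMap (Euc n) ℂ) (ξ - η) * ψ η * Complex.exp (Complex.I * t * ‖η‖) := by
    intro η
    rw [(hfd η).fderiv, SchwartzMap.lineDerivOp_apply_eq_fderiv]
    simp; ring
  have hφc : Continuous φ := by
    have : φ = fun η => ψ η * ((⟪e, η⟫ / ‖η‖ : ℝ) : ℂ) := funext hφ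
    rw [continuous_iff_continuousAt]
    intro η
    by_cases hη : η = 0
    · subst hη
      have : φ =ᶠ[nhds 0] fun _ => 0 := by
        filter_upwards [(isClosed_tsupport ψ).isOpen_compl.mem_nhds h0] with x hx
        rw [hφ, image_eq_zero_of_notMem_tsupport hx, zero_mul]
      exact (continuousAt_const).congr this.symm
    · rw [this]
      have : ‖η‖ ≠ 0 := by simpa
      have h2 : ContinuousAt (fun η : Euc n => ⟪e, η⟫ / ‖η‖) η := by
        apply ContinuousAt.div <;> first | assumption | fun_prop
      exact hψc.continuousAt.mul (Complex.continuous_ofReal.continuousAt.comp h2)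
  have hφs : HasCompactSupport φ := by
    have : φ = fun η => ψ η * ((⟪e, η⟫ / ‖η‖ : ℝ) : ℂ) := funext hφ
    rw [this]; exact hs.mul_right
  have i1 := GG_integrable B φ hφc hφs t ξ
  have i2 := GG_integrable B _ hψ'c hψ's t ξ
  have i3 := GG_integrable (∂_{e} B : SchwartzMap (Euc n) ℂ) ψ hψc hs t ξ
  have i4 := GG_integrable B ψ hψc hs t ξ
  have key := integral_mul_fderiv_eq_neg_fderiv_mul_of_integrable (μ := (volume : Measure (Euc n)))
    (f := fun η => B (ξ - η) * ψ η)
    (g := fun η : Euc n => Complex.exp (Complex.I * t * ‖η‖)) (v := e)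
    (by simp_rw [e2]; exact i2.sub i3) (by simp_rw [e1]; exact i1.const_mul _) i4
    (fun η _ => (hfd η).differentiableAt)
    (fun η hη => (hgd η (by
      rintro rfl
      exact h0 (tsupport_mul_subset_right hη))).differentiableAt)
  simp_rw [e1, e2] at key
  rw [integral_const_mul, integral_sub i2 i3] at key
  unfold GG
  rw [key]; ring

open LineDeriv in
lemma GG_decay2 {n : ℕ} (B : SchwartzMap (Euc n) ℂ) (φ ψ : Euc n → ℂ) (e : Euc n)
    (hψ : ContDiff ℝ 1 ψ) (hs : HasCompactSupport ψ) (h0 : (0 : Euc n) ∉ tsupport ψ)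
    (hφ : ∀ η, φ η = ψ η * ((⟪e, η⟫ / ‖η‖ : ℝ) : ℂ)) (hφc : Continuous φ)
    (hφs : HasCompactSupport φ) (N : ℕ) :
    ∃ K : ℝ, 0 ≤ K ∧ ∀ t ξ, (1 + |t|) * ((1 + ‖ξ‖) ^ N * ‖GG B φ t ξ‖) ≤ K := by
  have hψ'c : Continuous (fun η => fderiv ℝ ψ η e) :=
    (hψ.continuous_fderiv one_ne_zero).clm_apply continuous_const
  have hψ's : HasCompactSupport (fun η => fderiv ℝ ψ η e) := hs.fderiv_apply ℝ e
  obtain ⟨K1, hK1, h1⟩ := GG_decay B φ hφc hφs N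
  obtain ⟨K2, hK2, h2⟩ := GG_decay (∂_{e} B : SchwartzMap (Euc n) ℂ) ψ hψ.continuous hs N
  obtain ⟨K3, hK3, h3⟩ := GG_decay B _ hψ'c hψ's N
  refine ⟨K1 + (K2 + K3), by positivity, fun t ξ => ?_⟩
  have key := congrArg norm (GG_ibp B φ ψ e hψ hs h0 hφ t ξ)
  rw [norm_mul, norm_mul, Complex.norm_I, one_mul, Complex.norm_real, Real.norm_eq_abs] at key
  have h4 := norm_sub_le (GG (∂_{e} B : SchwartzMap (Euc n) ℂ) ψ t ξ)
    (GG B (fun η => fderiv ℝ ψ η e) t ξ)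
  have h5 : (1 + ‖ξ‖) ^ N * (|t| * ‖GG B φ t ξ‖) ≤ K2 + K3 := by
    rw [key]
    calc _ ≤ (1 + ‖ξ‖) ^ N * _ := mul_le_mul_of_nonneg_left h4 (by positivity)
      _ = _ := mul_add _ _ _
      _ ≤ _ := add_le_add (h2 t ξ) (h3 t ξ)
  have := h1 t ξ
  linarith

lemma GG_int {n : ℕ} (γ : ℝ) (hγ : 0 ≤ γ) (B : SchwartzMap (Euc n) ℂ) (φ ψ : Euc n → ℂ)
    (e : Euc n)
    (hψ : ContDiff ℝ 1 ψ) (hs : HasCompactSupport ψ) (h0 : (0 : Euc n) ∉ tsupport ψ)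
    (hφ : ∀ η, φ η = ψ η * ((⟪e, η⟫ / ‖η‖ : ℝ) : ℂ)) (hφc : Continuous φ)
    (hφs : HasCompactSupport φ) :
    (∀ t, Integrable (fun ξ : Euc n => (1 + ‖ξ‖ ^ 2) ^ γ * ‖GG B φ t ξ‖ ^ 2)) ∧
    Integrable (fun t => ∫ ξ : Euc n, (1 + ‖ξ‖ ^ 2) ^ γ * ‖GG B φ t ξ‖ ^ 2) := by
  obtain ⟨N, hN⟩ := exists_nat_gt (γ + n)
  obtain ⟨K, hK, hd⟩ := GG_decay2 B φ ψ e hψ hs h0 hφ hφc hφs N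
  have hcont : Continuous (fun p : ℝ × Euc n => (1 + ‖p.2‖ ^ 2) ^ γ * ‖GG B φ p.1 p.2‖ ^ 2) := by
    refine Continuous.mul ?_ ((GG_continuous B φ hφc hφs).norm.pow 2)
    exact Continuous.rpow_const (by fun_prop) (fun p => Or.inl (by positivity))
  have hr : (Module.finrank ℝ (Euc n) : ℝ) < 2 * N - 2 * γ := by
    simp
    have : (0:ℝ) ≤ n := Nat.cast_nonneg n
    linarith
  have hw := integrable_one_add_norm (μ := (volume : Measure (Euc n))) hr
  have hb : ∀ t (ξ : Euc n), (1 + ‖ξ‖ ^ 2) ^ γ * ‖GG B φ t ξ‖ ^ 2 ≤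
      (K ^ 2 * (1 + ‖t‖) ^ (-2 : ℝ)) * (1 + ‖ξ‖) ^ (-(2 * N - 2 * γ)) := by
    intro t ξ
    have ht : 0 < 1 + |t| := by positivity
    have hx : 0 < 1 + ‖ξ‖ := by positivity
    have h1 : (1 + ‖ξ‖ ^ 2) ^ γ ≤ (1 + ‖ξ‖) ^ (2 * γ) := by
      rw [Real.rpow_mul hx.le]
      apply Real.rpow_le_rpow (by positivity) _ hγ
      norm_num
      nlinarith [norm_nonneg ξ]
    have h2 : ‖GG B φ t ξ‖ ≤ K / ((1 + |t|) * (1 + ‖ξ‖) ^ N) := by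
      rw [le_div_iff₀ (by positivity)]
      calc _ = _ := by ring
        _ ≤ K := hd t ξ
    have h3 : (1 + ‖ξ‖) ^ (-(2 * N - 2 * γ)) = (1 + ‖ξ‖) ^ (2 * γ) / ((1 + ‖ξ‖) ^ N) ^ 2 := by
      rw [show -(2 * (N:ℝ) - 2 * γ) = 2 * γ - ((N * 2 : ℕ) : ℝ) by push_cast; ring,
        Real.rpow_sub hx, Real.rpow_natCast, pow_mul]
    have h4 : (1 + ‖t‖) ^ (-2 : ℝ) = 1 / (1 + |t|) ^ 2 := by
      rw [Real.norm_eq_abs, Real.rpow_neg ht.le]; norm_num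
    rw [h3, h4]
    calc (1 + ‖ξ‖ ^ 2) ^ γ * ‖GG B φ t ξ‖ ^ 2
        ≤ (1 + ‖ξ‖) ^ (2 * γ) * (K / ((1 + |t|) * (1 + ‖ξ‖) ^ N)) ^ 2 := by gcongr
      _ = _ := by field_simp
  have hA : ∀ t, Integrable (fun ξ : Euc n => (1 + ‖ξ‖ ^ 2) ^ γ * ‖GG B φ t ξ‖ ^ 2) := by
    intro t
    refine (hw.const_mul (K ^ 2 * (1 + ‖t‖) ^ (-2 : ℝ))).mono' ?_ ?_
    · exact (hcont.comp (by fun_prop : Continuous fun ξ : Euc n => (t, ξ))).aestronglyMeasurable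
    · refine Filter.Eventually.of_forall fun ξ => ?_
      rw [Real.norm_of_nonneg (by positivity)]
      exact hb t ξ
  refine ⟨hA, ?_⟩
  have h2 := integrable_one_add_norm (μ := (volume : Measure ℝ)) (r := 2) (by simp)
  refine ((h2.const_mul (K ^ 2)).mul_const
    (∫ ξ : Euc n, (1 + ‖ξ‖) ^ (-(2 * (N:ℝ) - 2 * γ)))).mono' ?_ ?_
  · exact (hcont.stronglyMeasurable.integral_prod_right).aestronglyMeasurable
  · refine Filter.Eventually.of_forall fun t => ?_
    rw [Real.norm_of_nonneg (integral_nonneg fun ξ => by positivity), ← integral_const_mul]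
    exact integral_mono (hA t) (hw.const_mul _) (hb t)

lemma fourier_formula {n : ℕ} (β f : SchwartzMap (Euc n) ℂ) (t : ℝ) (ξ : Euc n) :
    𝓕 (fun x => β x * halfWave t (fun y => f y) x) ξ
      = GG (𝓕 β : SchwartzMap (Euc n) ℂ) (𝓕 f : SchwartzMap (Euc n) ℂ) t ξ := by
  unfold GG halfWave mulOp
  rw [Real.fourier_eq']
  have hff : 𝓕 (fun y => f y) = ⇑(𝓕 f : SchwartzMap (Euc n) ℂ) := (SchwartzMap.fourier_coe f).symm
  have hbb : ∀ ζ, (𝓕 β : SchwartzMap (Euc n) ℂ) ζ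
      = ∫ v, Complex.exp ((↑(-2 * π * ⟪v, ζ⟫) * Complex.I)) • β v := fun ζ => by
    rw [SchwartzMap.fourier_coe, Real.fourier_eq']
  rw [hff]
  set g : SchwartzMap (Euc n) ℂ := 𝓕 f with hg
  have hβc := β.continuous
  have hgc := g.continuous
  set F : Euc n → Euc n → ℂ := fun x η =>
    Complex.exp ((↑(-2 * π * ⟪x, ξ - η⟫) * Complex.I)) * Complex.exp (Complex.I * t * ‖η‖)
      * (β x * g η) with hF
  have hFi : Integrable (Function.uncurry F) (volume.prod volume) := by
    refine (β.integrable.mul_prod g.integrable).mono ?_ ?_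
    · apply Continuous.aestronglyMeasurable
      simp only [hF, Function.uncurry_def]
      fun_prop
    · refine Filter.Eventually.of_forall fun p => ?_
      simp only [hF, Function.uncurry_def]
      rw [norm_mul, norm_mul, norm_osc, Complex.norm_exp_ofReal_mul_I, one_mul, one_mul]
  calc _ = ∫ x, ∫ η, F x η := by
        congr 1; ext x
        rw [← integral_const_mul, smul_eq_mul, ← integral_const_mul]
        congr 1; ext η
        simp only [hF, inner_sub_right]
        have : Complex.exp (↑(-2 * π * (⟪x, ξ⟫ - ⟪x, η⟫)) * Complex.I) =
          Complex.exp (↑(-2 * π * ⟪x, ξ⟫) * Complex.I)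
            * Complex.exp (2 * π * Complex.I * (⟪x, η⟫ : ℝ)) := by
          rw [← Complex.exp_add]; congr 1; push_cast; ring
        rw [this]; ring
    _ = ∫ η, ∫ x, F x η := integral_integral_swap hFi
    _ = _ := by
        congr 1; ext η
        rw [hbb, mul_assoc, ← integral_mul_const]
        congr 1; ext x
        simp only [hF, smul_eq_mul]; ring

lemma GG_lower {n : ℕ} (B : SchwartzMap (Euc n) ℂ) (φ : Euc n → ℝ) (hφc : Continuous φ)
    (hφs : HasCompactSupport φ) (hφ0 : ∀ η, 0 ≤ φ η) (ε δ : ℝ) (hε : 0 < ε)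
    (hφε : ∀ η, φ η ≠ 0 → ‖η‖ ≤ 2 * ε) (ξ₀ : Euc n) (hεδ : 2 * ε < δ)
    (hB : ∀ ζ, ‖ζ - ξ₀‖ < 2 * δ → ‖B ζ - B ξ₀‖ ≤ ‖B ξ₀‖ / 4) (t : ℝ) (ht : |t| ≤ 1 / (8 * ε))
    (ξ : Euc n) (hξ : ‖ξ - ξ₀‖ < δ) :
    ‖B ξ₀‖ / 2 * ∫ η, φ η ≤ ‖GG B (fun η => (φ η : ℂ)) t ξ‖ := by
  have hc : Continuous (fun η => (φ η : ℂ)) := by fun_prop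
  have hcs : HasCompactSupport (fun η => (φ η : ℂ)) :=
    hφs.comp_left (g := fun r : ℝ => (r : ℂ)) (by simp)
  have hφi : Integrable φ := hφc.integrable_of_hasCompactSupport hφs
  have i1 := GG_integrable B _ hc hcs t ξ
  have i2 : Integrable (fun η => B ξ₀ * (φ η : ℂ)) := (hφi.ofReal).const_mul _
  have h1 : ‖GG B (fun η => (φ η : ℂ)) t ξ - B ξ₀ * ((∫ η, φ η : ℝ) : ℂ)‖
      ≤ ‖B ξ₀‖ / 2 * ∫ η, φ η := by
    have : B ξ₀ * ((∫ η, φ η : ℝ) : ℂ) = ∫ η, B ξ₀ * (φ η : ℂ) := by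
      rw [integral_const_mul, integral_complex_ofReal]
    rw [this]
    unfold GG
    rw [← integral_sub i1 i2, ← integral_const_mul]
    apply norm_integral_le_of_norm_le (hφi.const_mul _)
    refine Filter.Eventually.of_forall fun η => ?_
    by_cases hη : φ η = 0
    · simp [hη]
    have hη2 := hφε η hη
    set E := Complex.exp (Complex.I * t * ‖η‖) with hE
    have hE1 : ‖E - 1‖ ≤ 1 / 4 := by
      have := Real.norm_exp_I_mul_ofReal_sub_one_le (x := t * ‖η‖)
      push_cast at this
      rw [← mul_assoc] at this
      refine this.trans ?_
      rw [norm_mul, norm_norm, Real.norm_eq_abs]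
      calc |t| * ‖η‖ ≤ 1 / (8 * ε) * (2 * ε) := by gcongr
        _ = 1 / 4 := by field_simp; norm_num
    have hE2 : ‖E‖ = 1 := norm_osc _ _
    have hB1 : ‖B (ξ - η) - B ξ₀‖ ≤ ‖B ξ₀‖ / 4 := by
      apply hB
      calc ‖ξ - η - ξ₀‖ = ‖(ξ - ξ₀) - η‖ := by congr 1; abel
        _ ≤ ‖ξ - ξ₀‖ + ‖η‖ := norm_sub_le _ _
        _ < 2 * δ := by linarith
    have e : B (ξ - η) * (φ η : ℂ) * E - B ξ₀ * (φ η : ℂ)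
        = ((B (ξ - η) - B ξ₀) * E + B ξ₀ * (E - 1)) * (φ η : ℂ) := by ring
    rw [e, norm_mul, Complex.norm_real, Real.norm_of_nonneg (hφ0 η)]
    gcongr
    · exact hφ0 η
    refine (norm_add_le _ _).trans ?_
    rw [norm_mul, norm_mul, hE2]
    nlinarith [norm_nonneg (B ξ₀)]
  have h2 : ‖B ξ₀ * ((∫ η, φ η : ℝ) : ℂ)‖ = ‖B ξ₀‖ * ∫ η, φ η := by
    rw [norm_mul, Complex.norm_real, Real.norm_of_nonneg (integral_nonneg hφ0)]
  have h3 := norm_sub_norm_le (B ξ₀ * ((∫ η, φ η : ℝ) : ℂ)) (GG B (fun η => (φ η : ℂ)) t ξ)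
  rw [norm_sub_rev, h2] at h3
  linarith

lemma bump_geom {n : ℕ} (e : Euc n) (he : ‖e‖ = 1) (ε : ℝ) (hε : 0 < ε) (η : Euc n)
    (hη : ‖η - ε • e‖ ≤ ε / 2) :
    ‖η‖ ≤ 2 * ε ∧ η ≠ 0 ∧ 1 / 3 ≤ ⟪e, η⟫ / ‖η‖ ∧ ⟪e, η⟫ / ‖η‖ ≤ 1 := by
  have h1 : ‖ε • e‖ = ε := by rw [norm_smul, he, mul_one, Real.norm_of_nonneg hε.le]
  have h2 : ‖η‖ ≤ ε / 2 + ε := by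
    have := norm_add_le (η - ε • e) (ε • e)
    rw [sub_add_cancel, h1] at this
    linarith
  have h3 : ε / 2 ≤ ⟪e, η⟫ := by
    have h4 : ⟪e, η⟫ = ⟪e, η - ε • e⟫ + ε := by
      rw [inner_sub_right, inner_smul_right, real_inner_self_eq_norm_sq, he]; ring
    have h5 := abs_real_inner_le_norm e (η - ε • e)
    rw [he, one_mul] at h5
    have := neg_abs_le ⟪e, η - ε • e⟫
    linarith
  have h0 : η ≠ 0 := by
    rintro rfl
    rw [inner_zero_right] at h3
    linarith
  have hpos : 0 < ‖η‖ := by positivity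
  refine ⟨by linarith, h0, ?_, ?_⟩
  · rw [le_div_iff₀ hpos]; linarith
  · rw [div_le_one hpos]
    have := real_inner_le_norm e η
    rwa [he, one_mul] at this

/-- The test function on the Fourier side. -/
lemma exists_test {n : ℕ} (e : Euc n) (he : ‖e‖ = 1) (ε : ℝ) (hε : 0 < ε) :
    ∃ (φ : Euc n → ℝ) (ψ : Euc n → ℂ), ContDiff ℝ (⊤ : ℕ∞) φ ∧ HasCompactSupport φ ∧
      ContDiff ℝ 1 ψ ∧ HasCompactSupport ψ ∧ (0 : Euc n) ∉ tsupport ψ ∧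
      (∀ η, (φ η : ℂ) = ψ η * ((⟪e, η⟫ / ‖η‖ : ℝ) : ℂ)) ∧
      (∀ η, 0 ≤ φ η) ∧ (∀ η, φ η ≤ 1) ∧
      (∀ η, φ η ≠ 0 → η ∈ Metric.ball (ε • e) (ε / 2)) ∧
      (∀ η ∈ Metric.ball (ε • e) (ε / 4), 1 / 3 ≤ φ η) := by
  let b : ContDiffBump (ε • e) := ⟨ε / 4, ε / 2, by positivity, by linarith⟩
  have hsupp : ∀ η, b η ≠ 0 → ‖η - ε • e‖ < ε / 2 := by
    intro η hη
    have : η ∈ Function.support b := hη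
    rw [b.support_eq, Metric.mem_ball, dist_eq_norm] at this
    exact this
  have h0 : (0 : Euc n) ∉ tsupport b := by
    rw [b.tsupport_eq, Metric.mem_closedBall, dist_eq_norm]
    intro h
    exact (bump_geom e he ε hε 0 h).2.1 rfl
  have hbs := b.hasCompactSupport
  have hts : tsupport (fun η => (b η : ℂ)) ⊆ tsupport b :=
    closure_mono fun η hη => by simpa using hη
  refine ⟨fun η => b η * (⟪e, η⟫ / ‖η‖), fun η => (b η : ℂ), ?_, hbs.mul_right, ?_,
    hbs.comp_left (g := fun r : ℝ => (r : ℂ)) (by simp), fun h => h0 (hts h), ?_, ?_, ?_, ?_, ?_⟩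
  · rw [contDiff_iff_contDiffAt]
    intro η
    by_cases hη : η = 0
    · subst hη
      have : (fun η => b η * (⟪e, η⟫ / ‖η‖)) =ᶠ[nhds 0] fun _ => 0 := by
        filter_upwards [(isClosed_tsupport b).isOpen_compl.mem_nhds h0] with x hx
        rw [image_eq_zero_of_notMem_tsupport hx, zero_mul]
      exact contDiffAt_const.congr_of_eventuallyEq this
    · refine b.contDiffAt.mul (ContDiffAt.div ?_ (contDiffAt_norm ℝ hη) (by simpa))
      exact contDiffAt_const.inner ℝ contDiffAt_id
  · exact Complex.ofRealCLM.contDiff.comp b.contDiff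
  · intro η; push_cast; ring
  · intro η
    by_cases hη : b η = 0
    · simp [hη]
    · have := bump_geom e he ε hε η (hsupp η hη).le
      exact mul_nonneg b.nonneg (by linarith [this.2.2.1])
  · intro η
    by_cases hη : b η = 0
    · simp [hη]
    · have := bump_geom e he ε hε η (hsupp η hη).le
      exact mul_le_one₀ b.le_one (by linarith [this.2.2.1]) this.2.2.2
  · intro η hη
    rw [Metric.mem_ball, dist_eq_norm]
    exact hsupp η (left_ne_zero_of_mul hη)
  · intro η hη
    have h1 : b η = 1 := b.one_of_mem_closedBall (Metric.ball_subset_closedBall hη)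
    rw [Metric.mem_ball, dist_eq_norm] at hη
    have := bump_geom e he ε hε η (by linarith)
    simp only [h1, one_mul]
    exact this.2.2.1

lemma vol_ball {n : ℕ} (x : Euc n) (r : ℝ) (hr : 0 < r) :
    volume.real (Metric.ball x r) = r ^ n * volume.real (Metric.ball (0 : Euc n) 1) := by
  unfold Measure.real
  rw [Measure.addHaar_ball_of_pos _ _ hr, ENNReal.toReal_mul, ENNReal.toReal_ofReal (by positivity)]
  simp

lemma vol_ball_pos {n : ℕ} (x : Euc n) (r : ℝ) (hr : 0 < r) :
    0 < volume.real (Metric.ball x r) :=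
  ENNReal.toReal_pos (Metric.measure_ball_pos _ _ hr).ne' measure_ball_lt_top.ne

lemma sq_half (x : ℝ) (hx : 0 ≤ x) : (x ^ (1/2 : ℝ)) ^ 2 = x := by
  rw [← Real.sqrt_eq_rpow, Real.sq_sqrt hx]

/-- Integral lower bound from a pointwise lower bound on a set. -/
lemma lower_int {α : Type*} [MeasurableSpace α] (μ : Measure α) (f : α → ℝ) (hf : Integrable f μ)
    (h0 : ∀ x, 0 ≤ f x) (s : Set α) (hs : MeasurableSet s) (hfin : μ s ≠ ⊤) (c : ℝ)
    (hc : ∀ x ∈ s, c ≤ f x) : c * μ.real s ≤ ∫ x, f x ∂μ := by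
  calc c * μ.real s = ∫ _ in s, c ∂μ := by simp [mul_comm]
    _ ≤ ∫ x in s, f x ∂μ := setIntegral_mono_on (integrableOn_const hfin) hf.integrableOn hs hc
    _ ≤ _ := setIntegral_le_integral hf (Filter.Eventually.of_forall h0)

lemma main_ineq (n : ℕ) (e : Euc n) (he : ‖e‖ = 1) (γ : ℝ) (hγ : 0 ≤ γ) (C : ℝ) (hC : 0 < C)
    (β : SchwartzMap (Euc n) ℂ)
    (h : ∀ f : SchwartzMap (Euc n) ℂ,
          (∫ t : ℝ, (iSob n γ (fun x => β x * halfWave t (fun y => f y) x)) ^ 2)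
            ≤ C * (hSob n γ (fun x => f x)) ^ 2)
    (ξ₀ : Euc n) (δ : ℝ) (hδ : 0 < δ)
    (hB : ∀ ζ, ‖ζ - ξ₀‖ < 2 * δ → ‖(𝓕 β : SchwartzMap (Euc n) ℂ) ζ -
      (𝓕 β : SchwartzMap (Euc n) ℂ) ξ₀‖ ≤ ‖(𝓕 β : SchwartzMap (Euc n) ℂ) ξ₀‖ / 4)
    (ε : ℝ) (hε : 0 < ε) (hεδ : 2 * ε < δ) :
    ((‖(𝓕 β : SchwartzMap (Euc n) ℂ) ξ₀‖ / 2 *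
        (1 / 3 * ((ε / 4) ^ n * volume.real (Metric.ball (0 : Euc n) 1)))) ^ 2
        * volume.real (Metric.ball ξ₀ δ)) * (1 / (8 * ε)) ≤
      C * ((2 * ε) ^ (2 * γ) * ((ε / 2) ^ n * volume.real (Metric.ball (0 : Euc n) 1))) := by
  obtain ⟨φ, ψ, hφ, hφs, hψ, hψs, h0, hφψ, hφ0, hφ1, hsupp, hlow⟩ := exists_test e he ε hε
  have hφc := hφ.continuous
  have hsupp2 : ∀ η, φ η ≠ 0 → ‖η‖ ≤ 2 * ε := fun η hη => by
    have := hsupp η hη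
    rw [Metric.mem_ball, dist_eq_norm] at this
    exact (bump_geom e he ε hε η this.le).1
  have hcs : HasCompactSupport (fun η => (φ η : ℂ)) :=
    hφs.comp_left (g := fun r : ℝ => (r : ℂ)) (by simp)
  have hcc : ContDiff ℝ (⊤ : ℕ∞) (fun η => (φ η : ℂ)) := Complex.ofRealCLM.contDiff.comp hφ
  set Φ : SchwartzMap (Euc n) ℂ := hcs.toSchwartzMap hcc with hΦ
  have hΦc : ⇑Φ = fun η => (φ η : ℂ) := rfl
  set f : SchwartzMap (Euc n) ℂ := 𝓕⁻ Φ with hf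
  have hff : (𝓕 f : SchwartzMap (Euc n) ℂ) = Φ := FourierTransform.fourier_fourierInv_eq Φ
  set B : SchwartzMap (Euc n) ℂ := 𝓕 β with hBdef
  set M : ℝ := 1 / 3 * ((ε / 4) ^ n * volume.real (Metric.ball (0 : Euc n) 1)) with hM
  have hM0 : 0 ≤ M := by positivity
  have hφi : Integrable φ := hφc.integrable_of_hasCompactSupport hφs
  have hMle : M ≤ ∫ η, φ η := by
    rw [hM, ← vol_ball (ε • e) (ε / 4) (by positivity)]
    exact lower_int _ φ hφi hφ0 _ measurableSet_ball measure_ball_lt_top.ne _ hlow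
  obtain ⟨hI1, hI2⟩ := GG_int γ hγ B (fun η => (φ η : ℂ)) ψ e hψ hψs h0 hφψ hcc.continuous hcs
  set J : ℝ → ℝ := fun t => ∫ ξ : Euc n, (1 + ‖ξ‖ ^ 2) ^ γ * ‖GG B (fun η => (φ η : ℂ)) t ξ‖ ^ 2
    with hJ
  have hJ0 : ∀ t, 0 ≤ J t := fun t => integral_nonneg fun ξ => by positivity
  have hiS : ∀ t, (iSob n γ (fun x => β x * halfWave t (fun y => f y) x)) ^ 2 = J t := by
    intro t
    unfold iSob
    simp_rw [fourier_formula β f t, hff, hΦc]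
    exact sq_half _ (hJ0 t)
  have hineq := h f
  simp_rw [hiS] at hineq
  have hhS : (hSob n γ (fun x => f x)) ^ 2 ≤
      (2 * ε) ^ (2 * γ) * ((ε / 2) ^ n * volume.real (Metric.ball (0 : Euc n) 1)) := by
    unfold hSob
    have hff' : 𝓕 (fun y => f y) = fun η => (φ η : ℂ) := by
      rw [← hΦc, ← hff]; exact (SchwartzMap.fourier_coe f).symm
    rw [sq_half _ (integral_nonneg fun ξ => by positivity), hff',
      ← vol_ball (ε • e) (ε / 2) (by positivity)]
    calc _ ≤ ∫ ξ, (Metric.ball (ε • e) (ε / 2)).indicator (fun _ => (2 * ε) ^ (2 * γ)) ξ := by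
          apply integral_mono_of_nonneg
          · exact Filter.Eventually.of_forall fun ξ => by positivity
          · exact (integrable_indicator_iff measurableSet_ball).2
              (integrableOn_const measure_ball_lt_top.ne)
          · refine Filter.Eventually.of_forall fun ξ => ?_
            by_cases hξ : φ ξ = 0
            · simp only [hξ, Complex.ofReal_zero, norm_zero]
              rw [zero_pow two_ne_zero, mul_zero]
              exact Set.indicator_nonneg (fun _ _ => by positivity) _
            · simp only [Set.indicator_of_mem (hsupp ξ hξ), Complex.norm_real,
                Real.norm_of_nonneg (hφ0 ξ)]
              calc _ ≤ (2 * ε) ^ (2 * γ) * 1 ^ 2 := by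
                    gcongr
                    · exact hsupp2 ξ hξ
                    · exact hφ0 ξ
                    · exact hφ1 ξ
                _ = _ := by ring
      _ = _ := by
          rw [integral_indicator measurableSet_ball]
          simp [mul_comm]
  have hJlow : ∀ t ∈ Set.Icc 0 (1 / (8 * ε)),
      (‖B ξ₀‖ / 2 * M) ^ 2 * volume.real (Metric.ball ξ₀ δ) ≤ J t := by
    intro t ht
    refine lower_int _ _ (hI1 t) (fun ξ => by positivity) _ measurableSet_ball
      measure_ball_lt_top.ne _ fun ξ hξ => ?_
    rw [Metric.mem_ball, dist_eq_norm] at hξ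
    have h1 := GG_lower B φ hφc hφs hφ0 ε δ hε hsupp2 ξ₀ hεδ hB t
      (by rw [abs_of_nonneg ht.1]; exact ht.2) ξ hξ
    have h2 : ‖B ξ₀‖ / 2 * M ≤ ‖GG B (fun η => (φ η : ℂ)) t ξ‖ :=
      (mul_le_mul_of_nonneg_left hMle (by positivity)).trans h1
    have h3 : 1 ≤ (1 + ‖ξ‖ ^ 2) ^ γ := Real.one_le_rpow (by nlinarith [norm_nonneg ξ]) hγ
    calc (‖B ξ₀‖ / 2 * M) ^ 2 ≤ ‖GG B (fun η => (φ η : ℂ)) t ξ‖ ^ 2 := by gcongr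
      _ = 1 * ‖GG B (fun η => (φ η : ℂ)) t ξ‖ ^ 2 := (one_mul _).symm
      _ ≤ _ := by gcongr
  have hfin := lower_int volume J hI2 hJ0 (Set.Icc 0 (1 / (8 * ε))) measurableSet_Icc
    measure_Icc_lt_top.ne _ hJlow
  rw [Real.volume_real_Icc_of_le (by positivity), sub_zero] at hfin
  exact hfin.trans (hineq.trans (mul_le_mul_of_nonneg_left hhS hC.le))

/-- (Sharpness of the local smoothing exponent) For `n ≥ 2` and `γ > (n-1)/2` there
is no constant `C` and no `β ∈ C₀^∞(ℝⁿ)` with `β ≡ 1` on the unit ball such that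
`∫ ‖β e^{it|D|} f‖²_{H^γ} dt ≤ C ‖f‖²_{Ḣ^γ}` for all Schwartz `f`. -/
theorem stmt5 (n : ℕ) (hn : 2 ≤ n) (γ : ℝ) (hγ : ((n : ℝ) - 1) / 2 < γ) :
    ¬ ∃ (C : ℝ) (β : Euc n → ℂ), 0 < C ∧
        ContDiff ℝ (⊤ : ℕ∞) β ∧ HasCompactSupport β ∧
        (∀ x : Euc n, ‖x‖ ≤ 1 → β x = 1) ∧
        (∀ f : SchwartzMap (Euc n) ℂ,
          (∫ t : ℝ, (iSob n γ (fun x => β x * halfWave t (fun y => f y) x)) ^ 2)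
            ≤ C * (hSob n γ (fun x => f x)) ^ 2) := by

  rintro ⟨C, β, hC, hβ, hβs, hβ1, h⟩
  have hn0 : 0 < n := by omega
  have hnR : (2:ℝ) ≤ n := by exact_mod_cast hn
  have hγ0 : 0 ≤ γ := by linarith
  set e : Euc n := EuclideanSpace.single ⟨0, hn0⟩ (1:ℝ) with he
  have he1 : ‖e‖ = 1 := by simp [he]
  set b : SchwartzMap (Euc n) ℂ := hβs.toSchwartzMap hβ with hb
  have hbc : ⇑b = β := rfl
  have hne : ∃ ξ₀, (𝓕 b : SchwartzMap (Euc n) ℂ) ξ₀ ≠ 0 := by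
    by_contra hcon
    push Not at hcon
    have h1 : (𝓕 b : SchwartzMap (Euc n) ℂ) = 0 := by ext x; simpa using hcon x
    have h2 : b = 0 := by
      have : 𝓕⁻ (𝓕 b : SchwartzMap (Euc n) ℂ) = b := FourierTransform.fourierInv_fourier_eq b
      rw [h1] at this
      rw [← this]
      ext x
      rw [SchwartzMap.fourierInv_coe, Real.fourierInv_eq]
      simp
    have h3 : b 0 = 1 := hβ1 0 (by simp)
    rw [h2] at h3
    simp at h3
  obtain ⟨ξ₀, hξ₀⟩ := hne
  have hpos : 0 < ‖(𝓕 b : SchwartzMap (Euc n) ℂ) ξ₀‖ := by positivity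
  obtain ⟨d, hd, hdB⟩ := Metric.continuousAt_iff.1
    ((𝓕 b : SchwartzMap (Euc n) ℂ).continuous.continuousAt (x := ξ₀))
    (‖(𝓕 b : SchwartzMap (Euc n) ℂ) ξ₀‖ / 4) (by positivity)
  have key := main_ineq n e he1 γ hγ0 C hC b h ξ₀ (d / 2) (by positivity) (fun ζ hζ => by
    have := hdB (x := ζ) (by rw [dist_eq_norm]; linarith)
    rw [dist_eq_norm] at this
    exact this.le)
  set b0 := ‖(𝓕 b : SchwartzMap (Euc n) ℂ) ξ₀‖
  have hV := vol_ball_pos (0 : Euc n) 1 one_pos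
  have hW := vol_ball_pos ξ₀ (d / 2) (by positivity)
  set V := volume.real (Metric.ball (0 : Euc n) 1)
  set W := volume.real (Metric.ball ξ₀ (d / 2))
  set c1 : ℝ := (b0 / 2 * (1 / 3 * ((1 / 4) ^ n * V))) ^ 2 * W * (1 / 8) with hc1
  set c2 : ℝ := C * (2 ^ (2 * γ) * ((1 / 2) ^ n * V)) with hc2
  have hc1p : 0 < c1 := by positivity
  have hall : ∀ ε : ℝ, 0 < ε → 2 * ε < d / 2 → c1 ≤ c2 * ε ^ (2 * γ + 1 - n) := by
    intro ε hε hεd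
    have hk := key ε hε hεd
    rw [Real.mul_rpow (by norm_num) hε.le, div_pow, div_pow] at hk
    rw [Real.rpow_sub hε, Real.rpow_add hε, Real.rpow_one, Real.rpow_natCast]
    have hεn : 0 < ε ^ n := by positivity
    have l1 : (b0 / 2 * (1 / 3 * (ε ^ n / 4 ^ n * V))) ^ 2 * W * (1 / (8 * ε))
        = c1 * ((ε ^ n) ^ 2 / ε) := by
      rw [hc1, div_pow 1 (4:ℝ), one_pow]; field_simp
    have l2 : C * (2 ^ (2 * γ) * ε ^ (2 * γ) * (ε ^ n / 2 ^ n * V))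
        = (c2 * (ε ^ (2 * γ) * ε / ε ^ n)) * ((ε ^ n) ^ 2 / ε) := by
      rw [hc2, div_pow, one_pow]; field_simp
    rw [l1, l2] at hk
    exact le_of_mul_le_mul_right hk (by positivity)
  have hexp : 0 < 2 * γ + 1 - n := by linarith
  have hlim : Filter.Tendsto (fun ε : ℝ => c2 * ε ^ (2 * γ + 1 - n)) (nhdsWithin 0 (Set.Ioi 0))
      (nhds 0) := by
    have h1 : ContinuousAt (fun ε : ℝ => c2 * ε ^ (2 * γ + 1 - n)) 0 :=
      continuousAt_const.mul (Real.continuousAt_rpow_const _ _ (Or.inr hexp.le))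
    have h2 := h1.tendsto
    simp only [Real.zero_rpow hexp.ne', mul_zero] at h2
    exact h2.mono_left nhdsWithin_le_nhds
  have hle : c1 ≤ 0 := by
    refine ge_of_tendsto hlim ?_
    filter_upwards [Ioo_mem_nhdsGT (show (0:ℝ) < d / 4 by positivity)] with ε hε
    exact hall ε hε.1 (by linarith [hε.2])
  linarith

end
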